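/- arXiv:cs/0411008 — 2 statements merged into one kernel-verified Lean document; each statement's English description precedes it below -/
import Mathlib

section
/- For all m ≥ 1, p, q ≥ 0 and pairwise distinct general atoms W₁,…,W_p, R₁,…,R_m, S₁,…,S_m, U₁,…,U_q, the formula ((R₁→S₁)∧…∧(R_m→S_m)) → (W₁∧…∧W_p∧R₁∧…∧R_m∧U₁∧…∧U_q → W₁∧…∧W_p∧S₁∧…∧S_m∧U₁∧…∧U_q) is provable in CL2. -/
/-- CL2-formulas: logical atoms ⊤/⊥, elementary atoms, general atoms,
negation, n-ary ∧, ∨, ⊓, ⊔ (arities other than ≥2 never arise in derivations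
of proper formulas). -/
inductive CL2 : Type where
  | top : CL2
  | bot : CL2
  | elem : Nat → CL2
  | gen : Nat → CL2
  | neg : CL2 → CL2
  | land : List CL2 → CL2
  | lor : List CL2 → CL2
  | chand : List CL2 → CL2
  | chor : List CL2 → CL2

namespace CL2

/-- Elementarization (with a polarity parameter): surface ⊓ becomes ⊤, surface ⊔
becomes ⊥, positive surface general atoms become ⊥, negative ones ⊤. -/
def elz (pos : Bool) : CL2 → CL2
  | top => top
  | bot => bot
  | elem n => elem n
  | gen _ => if pos then bot else top
  | neg F => neg (elz (!pos) F)
  | land l => land (l.attach.map (fun x => elz pos x.1))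
  | lor l => lor (l.attach.map (fun x => elz pos x.1))
  | chand _ => top
  | chor _ => bot
termination_by F => sizeOf F
decreasing_by
  all_goals simp_wf
  all_goals first
    | omega
    | (have h := List.sizeOf_lt_of_mem x.2; omega)

/-- Classical evaluation (used on elementarizations, which contain no
general atoms and no ⊓/⊔). -/
def eval (v : Nat → Bool) : CL2 → Bool
  | top => true
  | bot => false
  | elem n => v n
  | gen _ => false
  | neg F => !(eval v F)
  | land l => (l.attach.map (fun x => eval v x.1)).all id
  | lor l => (l.attach.map (fun x => eval v x.1)).any id
  | chand _ => true
  | chor _ => false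
termination_by F => sizeOf F
decreasing_by
  all_goals simp_wf
  all_goals first
    | omega
    | (have h := List.sizeOf_lt_of_mem x.2; omega)

/-- F is stable iff its elementarization is a classical tautology. -/
def Stable (F : CL2) : Prop := ∀ v : Nat → Bool, eval v (elz true F) = true

/-- Whether the elementary atom `p` occurs (anywhere) in a formula. -/
def elemOccurs (p : Nat) : CL2 → Bool
  | top => false
  | bot => false
  | elem n => n == p
  | gen _ => false
  | neg F => elemOccurs p F
  | land l => (l.attach.map (fun x => elemOccurs p x.1)).any id
  | lor l => (l.attach.map (fun x => elemOccurs p x.1)).any id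
  | chand l => (l.attach.map (fun x => elemOccurs p x.1)).any id
  | chor l => (l.attach.map (fun x => elemOccurs p x.1)).any id
termination_by F => sizeOf F
decreasing_by
  all_goals simp_wf
  all_goals first
    | omega
    | (have h := List.sizeOf_lt_of_mem x.2; omega)

end CL2

/-- One-hole surface contexts: the hole is not in the scope of ⊓ or ⊔. -/
inductive SCtx : Type where
  | hole : SCtx
  | neg : SCtx → SCtx
  | land : List CL2 → SCtx → List CL2 → SCtx
  | lor : List CL2 → SCtx → List CL2 → SCtx

namespace SCtx

def fill : SCtx → CL2 → CL2
  | hole, F => F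
  | neg C, F => CL2.neg (fill C F)
  | land l C r, F => CL2.land (l ++ fill C F :: r)
  | lor l C r, F => CL2.lor (l ++ fill C F :: r)

/-- Number of negations the hole is in the scope of. -/
def negCount : SCtx → Nat
  | hole => 0
  | neg C => negCount C + 1
  | land _ C _ => negCount C
  | lor _ C _ => negCount C

end SCtx

/-- Two-hole surface contexts (the two holes are distinct surface occurrences,
so their least common ancestor is an ∧- or ∨-node). -/
inductive DCtx : Type where
  | neg : DCtx → DCtx
  | land : List CL2 → DCtx → List CL2 → DCtx
  | lor : List CL2 → DCtx → List CL2 → DCtx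
  | landS : List CL2 → SCtx → List CL2 → SCtx → List CL2 → DCtx
  | lorS : List CL2 → SCtx → List CL2 → SCtx → List CL2 → DCtx

namespace DCtx

def fill2 : DCtx → CL2 → CL2 → CL2
  | neg D, A, B => CL2.neg (fill2 D A B)
  | land l D r, A, B => CL2.land (l ++ fill2 D A B :: r)
  | lor l D r, A, B => CL2.lor (l ++ fill2 D A B :: r)
  | landS l C1 m C2 r, A, B => CL2.land (l ++ C1.fill A :: m ++ C2.fill B :: r)
  | lorS l C1 m C2 r, A, B => CL2.lor (l ++ C1.fill A :: m ++ C2.fill B :: r)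

def negCount1 : DCtx → Nat
  | neg D => negCount1 D + 1
  | land _ D _ => negCount1 D
  | lor _ D _ => negCount1 D
  | landS _ C1 _ _ _ => C1.negCount
  | lorS _ C1 _ _ _ => C1.negCount

def negCount2 : DCtx → Nat
  | neg D => negCount2 D + 1
  | land _ D _ => negCount2 D
  | lor _ D _ => negCount2 D
  | landS _ _ _ C2 _ => C2.negCount
  | lorS _ _ _ C2 _ => C2.negCount

end DCtx

/-- The premises of Rule (a) with conclusion `F`: results of replacing a positive
surface occurrence of a ⊓-subformula, or a negative surface occurrence of a
⊔-subformula, by one of its components. -/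
def PremiseA (F H : CL2) : Prop :=
  ∃ (C : SCtx) (Gs : List CL2) (i : Fin Gs.length),
    (Even C.negCount ∧ F = C.fill (CL2.chand Gs) ∧ H = C.fill (Gs.get i)) ∨
    (Odd C.negCount ∧ F = C.fill (CL2.chor Gs) ∧ H = C.fill (Gs.get i))

/-- The premise of Rule (b): `H` results from replacing in `F` a negative surface
occurrence of a ⊓-subformula, or a positive surface occurrence of a ⊔-subformula,
by one of its components. -/
def PremiseB (F H : CL2) : Prop :=
  ∃ (C : SCtx) (Gs : List CL2) (i : Fin Gs.length),
    (Odd C.negCount ∧ F = C.fill (CL2.chand Gs) ∧ H = C.fill (Gs.get i)) ∨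
    (Even C.negCount ∧ F = C.fill (CL2.chor Gs) ∧ H = C.fill (Gs.get i))

/-- The premise of Rule (c): `H` results from replacing in `F` two — one positive
and one negative — surface occurrences of a general atom by an elementary atom
not occurring in `F`. -/
def PremiseC (F H : CL2) : Prop :=
  ∃ (D : DCtx) (P p : Nat),
    F = D.fill2 (CL2.gen P) (CL2.gen P) ∧
    H = D.fill2 (CL2.elem p) (CL2.elem p) ∧
    ((Even D.negCount1 ∧ Odd D.negCount2) ∨ (Odd D.negCount1 ∧ Even D.negCount2)) ∧
    CL2.elemOccurs p F = false

/-- CL2-provability. -/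
inductive Provable : CL2 → Prop where
  | ruleA (F : CL2) : CL2.Stable F → (∀ H, PremiseA F H → Provable H) → Provable F
  | ruleB (F H : CL2) : PremiseB F H → Provable H → Provable F
  | ruleC (F H : CL2) : PremiseC F H → Provable H → Provable F

/-- Implication: F → G abbreviates ¬F ∨ G. -/
def CL2.imp (F G : CL2) : CL2 := CL2.lor [CL2.neg F, G]

/-- `conjImp [F₁,…,Fₙ] T` is F₁∧…∧Fₙ → T, with the conventions that for n = 1 it
is F₁ → T and for n = 0 it is T. -/
def conjImp (l : List CL2) (t : CL2) : CL2 :=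
  match l with
  | [] => t
  | [f] => CL2.imp f t
  | l => CL2.imp (CL2.land l) t

/-- `conj1 [F₁,…,Fₙ]` is F₁∧…∧Fₙ, with the convention that for n = 1 it is F₁. -/
def conj1 (l : List CL2) : CL2 :=
  match l with
  | [f] => f
  | l => CL2.land l

namespace CL2

theorem elz_land (b : Bool) (l : List CL2) : elz b (land l) = land (l.map (elz b)) := by
  rw [elz, List.attach_map_val (f := elz b)]

theorem elz_lor (b : Bool) (l : List CL2) : elz b (lor l) = lor (l.map (elz b)) := by
  rw [elz, List.attach_map_val (f := elz b)]

theorem eval_land (v : Nat → Bool) (l : List CL2) : eval v (land l) = l.all (eval v) := by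
  rw [eval, List.attach_map_val (f := eval v), List.all_map]
  rfl

theorem eval_lor (v : Nat → Bool) (l : List CL2) : eval v (lor l) = l.any (eval v) := by
  rw [eval, List.attach_map_val (f := eval v), List.any_map]
  rfl

theorem elemOccurs_land (p : Nat) (l : List CL2) :
    elemOccurs p (land l) = l.any (elemOccurs p) := by
  rw [elemOccurs, List.attach_map_val (f := elemOccurs p), List.any_map]
  rfl

theorem elemOccurs_lor (p : Nat) (l : List CL2) :
    elemOccurs p (lor l) = l.any (elemOccurs p) := by
  rw [elemOccurs, List.attach_map_val (f := elemOccurs p), List.any_map]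
  rfl

theorem elemOccurs_imp (p : Nat) (F G : CL2) :
    elemOccurs p (imp F G) = (elemOccurs p F || elemOccurs p G) := by
  simp [imp, elemOccurs_lor, elemOccurs]

theorem eval_elz_imp (v : Nat → Bool) (b : Bool) (F G : CL2) :
    eval v (elz b (imp F G)) = (!eval v (elz (!b) F) || eval v (elz b G)) := by
  simp [imp, elz_lor, eval_lor, elz, eval]

/-- Formulas built from elementary nonlogical atoms by ¬, ∧, ∨ only. -/
inductive IsElementary : CL2 → Prop
  | elem (n : Nat) : IsElementary (elem n)
  | neg {F : CL2} : IsElementary F → IsElementary (neg F)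
  | land {l : List CL2} : (∀ F ∈ l, IsElementary F) → IsElementary (land l)
  | lor {l : List CL2} : (∀ F ∈ l, IsElementary F) → IsElementary (lor l)

theorem IsElementary.imp {F G : CL2} (hF : IsElementary F) (hG : IsElementary G) :
    IsElementary (imp F G) := by
  refine .lor fun H hH => ?_
  simp only [List.mem_cons, List.not_mem_nil, or_false] at hH
  rcases hH with rfl | rfl
  exacts [hF.neg, hG]

theorem IsElementary.of_fill {F : CL2} (C : SCtx) (h : IsElementary (C.fill F)) :
    IsElementary F := by
  induction C with
  | hole => exact h
  | neg C ih => cases h with | neg h => exact ih h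
  | land l C r ih => cases h with | land h => exact ih (h _ (by simp))
  | lor l C r ih => cases h with | lor h => exact ih (h _ (by simp))

/-- A stable elementary formula follows by Rule (a) from the empty set of premises. -/
theorem IsElementary.provable {F : CL2} (hF : IsElementary F) (hs : Stable F) : Provable F := by
  refine .ruleA F hs ?_
  rintro H ⟨C, Gs, i, ⟨-, rfl, -⟩ | ⟨-, rfl, -⟩⟩ <;> cases hF.of_fill C

end CL2

open CL2

theorem conj1_eq_or (l : List CL2) : conj1 l = land l ∨ l = [conj1 l] := by
  unfold conj1
  split <;> simp

theorem elemOccurs_conj1 (p : Nat) (l : List CL2) :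
    elemOccurs p (conj1 l) = l.any (elemOccurs p) := by
  rcases conj1_eq_or l with h | h
  · rw [h, elemOccurs_land]
  · conv_rhs => rw [h]
    simp

theorem eval_elz_conj1 (v : Nat → Bool) (b : Bool) (l : List CL2) :
    eval v (elz b (conj1 l)) = l.all fun F => eval v (elz b F) := by
  rcases conj1_eq_or l with h | h
  · rw [h, elz_land, eval_land, List.all_map]
    rfl
  · conv_rhs => rw [h]
    simp

theorem CL2.IsElementary.conj1 {l : List CL2} (h : ∀ F ∈ l, IsElementary F) :
    IsElementary (conj1 l) := by
  rcases conj1_eq_or l with hl | hl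
  · rw [hl]
    exact .land h
  · rw [hl] at h
    exact h _ (List.mem_singleton_self _)

theorem conjImp_of_ne_nil {l : List CL2} (hl : l ≠ []) (t : CL2) :
    conjImp l t = imp (conj1 l) t := by
  match l with
  | [] => exact absurd rfl hl
  | [_] => rfl
  | _ :: _ :: _ => rfl

theorem exists_fill_eq_conj1 (l r : List CL2) (C₀ : SCtx) :
    ∃ C : SCtx, C.negCount = C₀.negCount ∧ ∀ F, conj1 (l ++ C₀.fill F :: r) = C.fill F := by
  match l, r with
  | [], [] => exact ⟨C₀, rfl, fun _ => rfl⟩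
  | [], y :: r => exact ⟨.land [] C₀ (y :: r), rfl, fun _ => rfl⟩
  | [x], r => exact ⟨.land [x] C₀ r, rfl, fun _ => rfl⟩
  | x :: y :: l, r => exact ⟨.land (x :: y :: l) C₀ r, rfl, fun _ => rfl⟩

/-- If only the entry at `a` of a list of conjuncts depends on `F`, and does so through the surface
context `C₀`, then the whole conjunction is a surface context of `F` of the same polarity. -/
theorem exists_fill_eq_conj1_map {α : Type*} {l : List α} (hl : l.Nodup) {a : α} (ha : a ∈ l)
    (g : CL2 → α → CL2) (C₀ : SCtx) (hC₀ : ∀ F, g F a = C₀.fill F)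
    (hg : ∀ b ∈ l, b ≠ a → ∀ F, g F b = g bot b) :
    ∃ C : SCtx, C.negCount = C₀.negCount ∧ ∀ F, conj1 (l.map (g F)) = C.fill F := by
  obtain ⟨s, t, rfl⟩ := List.append_of_mem ha
  obtain ⟨C, hC, h⟩ := exists_fill_eq_conj1 (s.map (g bot)) (t.map (g bot)) C₀
  refine ⟨C, hC, fun F => ?_⟩
  rw [← h, List.map_append, List.map_cons, hC₀]
  have hs : s.map (g F) = s.map (g bot) :=
    List.map_congr_left fun b hb => hg b (by simp [hb]) (by rintro rfl; grind) F
  have ht : t.map (g F) = t.map (g bot) :=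
    List.map_congr_left fun b hb => hg b (by simp [hb]) (by rintro rfl; grind) F
  rw [hs, ht]

theorem exists_fill_eq_conj1_update {l : List Nat} (hl : l.Nodup) {X : Nat} (hX : X ∈ l)
    (σ : Nat → CL2) :
    ∃ C : SCtx, C.negCount = 0 ∧
      ∀ F, conj1 (l.map (Function.update σ X F)) = C.fill F :=
  exists_fill_eq_conj1_map hl hX (fun F => Function.update σ X F) .hole
    (fun _ => by simp [SCtx.fill]) fun b _ hb _ => by simp [hb]

theorem map_update_of_notMem {l : List Nat} {X : Nat} (hX : X ∉ l) (σ : Nat → CL2) (F : CL2) :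
    l.map (Function.update σ X F) = l.map σ :=
  List.map_congr_left fun b hb => Function.update_of_ne (by rintro rfl; exact hX hb) _ _

/-- `(⋀ᵢ (σ Rᵢ → σ Sᵢ)) → (⋀ σ A → ⋀ σ B)`: the shape of the monotonicity formula, with formulas
`σ X` in place of the atoms `X`. -/
def monoFormula {m : Nat} (R S : Fin m → Nat) (A B : List Nat) (σ : Nat → CL2) : CL2 :=
  imp (conj1 ((List.finRange m).map fun i => imp (σ (R i)) (σ (S i))))
    (imp (conj1 (A.map σ)) (conj1 (B.map σ)))

/-- In `monoFormula R S A B`, the atom `X` occurs exactly twice, with opposite polarities. -/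
def OccursTwice {m : Nat} (R S : Fin m → Nat) (A B : List Nat) (X : Nat) : Prop :=
  (X ∈ A ∧ X ∈ B ∧ (∀ i, R i ≠ X) ∧ ∀ i, S i ≠ X) ∨
  ((∃ i, R i = X) ∧ X ∈ A ∧ X ∉ B ∧ ∀ i, S i ≠ X) ∨
  ((∃ i, S i = X) ∧ X ∉ A ∧ X ∈ B ∧ ∀ i, R i ≠ X)

section

variable {m : Nat} {R S : Fin m → Nat} {A B : List Nat}

theorem exists_fill2_eq_monoFormula (hR : R.Injective) (hS : S.Injective) (hA : A.Nodup)
    (hB : B.Nodup) {X : Nat} (hX : OccursTwice R S A B X) (σ : Nat → CL2) :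
    ∃ D : DCtx,
      ((Even D.negCount1 ∧ Odd D.negCount2) ∨ (Odd D.negCount1 ∧ Even D.negCount2)) ∧
      ∀ F, monoFormula R S A B (Function.update σ X F) = D.fill2 F F := by
  rcases hX with ⟨hXA, hXB, hXR, hXS⟩ | ⟨⟨i, rfl⟩, hXA, hXB, hXS⟩ | ⟨⟨i, rfl⟩, hXA, hXB, hXR⟩
  · obtain ⟨C₁, h₁, e₁⟩ := exists_fill_eq_conj1_update hA hXA σ
    obtain ⟨C₂, h₂, e₂⟩ := exists_fill_eq_conj1_update hB hXB σ
    refine ⟨.lor [neg (conj1 ((List.finRange m).map fun i => imp (σ (R i)) (σ (S i))))]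
      (.lorS [] (.neg C₁) [] C₂ []) [], .inr ?_, fun F => ?_⟩
    · simp [DCtx.negCount1, DCtx.negCount2, SCtx.negCount, h₁, h₂]
    · simp [monoFormula, imp, DCtx.fill2, SCtx.fill, e₁, e₂, hXR, hXS]
  · obtain ⟨C₁, h₁, e₁⟩ := exists_fill_eq_conj1_map (List.nodup_finRange m) (List.mem_finRange i)
      (fun F j => imp (Function.update σ (R i) F (R j)) (Function.update σ (R i) F (S j)))
      (.lor [] (.neg .hole) [σ (S i)]) (fun F => by simp [imp, SCtx.fill, hXS])
      fun j _ hj F => by simp [hR.ne hj, hXS]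
    obtain ⟨C₂, h₂, e₂⟩ := exists_fill_eq_conj1_update hA hXA σ
    refine ⟨.lorS [] (.neg C₁) [] (.lor [] (.neg C₂) [conj1 (B.map σ)]) [], .inl ?_, fun F => ?_⟩
    · simp [DCtx.negCount1, DCtx.negCount2, SCtx.negCount, h₁, h₂]
    · rw [monoFormula, e₁, e₂, map_update_of_notMem hXB]
      rfl
  · obtain ⟨C₁, h₁, e₁⟩ := exists_fill_eq_conj1_map (List.nodup_finRange m) (List.mem_finRange i)
      (fun F j => imp (Function.update σ (S i) F (R j)) (Function.update σ (S i) F (S j)))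
      (.lor [neg (σ (R i))] .hole []) (fun F => by simp [imp, SCtx.fill, hXR])
      fun j _ hj F => by simp [hS.ne hj, hXR]
    obtain ⟨C₂, h₂, e₂⟩ := exists_fill_eq_conj1_update hB hXB σ
    refine ⟨.lorS [] (.neg C₁) [] (.lor [neg (conj1 (A.map σ))] C₂ []) [], .inr ?_, fun F => ?_⟩
    · simp [DCtx.negCount1, DCtx.negCount2, SCtx.negCount, h₁, h₂]
    · rw [monoFormula, e₁, e₂, map_update_of_notMem hXA]
      rfl

theorem monoFormula_congr {σ τ : Nat → CL2} (hR : ∀ i, σ (R i) = τ (R i))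
    (hS : ∀ i, σ (S i) = τ (S i)) (hA : ∀ X ∈ A, σ X = τ X) (hB : ∀ X ∈ B, σ X = τ X) :
    monoFormula R S A B σ = monoFormula R S A B τ := by
  simp only [monoFormula, hR, hS, List.map_congr_left hA, List.map_congr_left hB]

theorem elemOccurs_monoFormula {p : Nat} {σ : Nat → CL2} (h : ∀ X, elemOccurs p (σ X) = false) :
    elemOccurs p (monoFormula R S A B σ) = false := by
  simp [monoFormula, elemOccurs_imp, elemOccurs_conj1, h]

theorem provable_monoFormula_elem (hB : ∀ X ∈ B, X ∈ A ∨ ∃ i, S i = X) (hR : ∀ i, R i ∈ A) :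
    Provable (monoFormula R S A B elem) := by
  refine IsElementary.provable ?_ fun v => ?_
  · refine .imp (.conj1 ?_) (.imp (.conj1 ?_) (.conj1 ?_)) <;> simp only [List.mem_map] <;>
      rintro _ ⟨_, -, rfl⟩
    exacts [.imp (.elem _) (.elem _), .elem _, .elem _]
  · suffices (∀ i, v (R i) = true → v (S i) = true) → (∀ X ∈ A, v X = true) →
        ∀ X ∈ B, v X = true by
      by_contra hF
      simp [monoFormula, eval_elz_imp, eval_elz_conj1, elz, eval] at hF
      grind
    intro h hA X hX
    rcases hB X hX with hX | ⟨i, rfl⟩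
    exacts [hA X hX, h i (hA _ (hR i))]

/-- The instance of the monotonicity formula in which the atoms in `L` are general and all others
are elementary. Each general atom `X` is discharged by Rule (c) with the elementary atom `X`. -/
theorem provable_monoFormula (hRinj : R.Injective) (hSinj : S.Injective) (hA : A.Nodup)
    (hBnd : B.Nodup) (hB : ∀ X ∈ B, X ∈ A ∨ ∃ i, S i = X) (hR : ∀ i, R i ∈ A)
    (L : List Nat) (hL : L.Nodup) (hocc : ∀ X ∈ L, OccursTwice R S A B X) :
    Provable (monoFormula R S A B fun X => if X ∈ L then gen X else elem X) := by
  induction L with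
  | nil => simpa using provable_monoFormula_elem hB hR
  | cons X L ih =>
    rw [List.nodup_cons] at hL
    obtain ⟨D, hD, e⟩ := exists_fill2_eq_monoFormula hRinj hSinj hA hBnd (hocc X (by simp))
      fun Y => if Y ∈ L then gen Y else elem Y
    refine .ruleC _ _ ⟨D, X, X, ?_, ?_, hD, ?_⟩
      (ih hL.2 fun Y hY => hocc Y (List.mem_cons_of_mem _ hY))
    · rw [← e]
      congr 1
      funext Y
      by_cases hY : Y = X <;> simp [hY]
    · rw [← e, Function.update_eq_self_iff.2]
      simp [hL.1]
    · refine elemOccurs_monoFormula fun Y => ?_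
      split_ifs with hY
      · simp [elemOccurs]
      · simp only [List.mem_cons, not_or] at hY
        simp [elemOccurs, hY.1]

end

/-- Lemma 8(c): for all m ≥ 1, p, q ≥ 0 and pairwise distinct general atoms
W₁,…,W_p, R₁,…,R_m, S₁,…,S_m, U₁,…,U_q, the formula
((R₁→S₁)∧…∧(R_m→S_m)) → (W₁∧…∧W_p∧R₁∧…∧R_m∧U₁∧…∧U_q → W₁∧…∧W_p∧S₁∧…∧S_m∧U₁∧…∧U_q)
is provable in CL2. -/
theorem cl2_provable_mono (m p q : Nat) (hm : 1 ≤ m)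
    (W : Fin p → Nat) (R S : Fin m → Nat) (U : Fin q → Nat)
    (hdist : (List.ofFn W ++ List.ofFn R ++ List.ofFn S ++ List.ofFn U).Nodup) :
    Provable (CL2.imp
      (conj1 (List.ofFn fun i => CL2.imp (CL2.gen (R i)) (CL2.gen (S i))))
      (conjImp
        ((List.ofFn W).map CL2.gen ++ (List.ofFn R).map CL2.gen ++ (List.ofFn U).map CL2.gen)
        (conj1
          ((List.ofFn W).map CL2.gen ++ (List.ofFn S).map CL2.gen ++
            (List.ofFn U).map CL2.gen)))) := by
  have key := provable_monoFormula (R := R) (S := S)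
    (A := List.ofFn W ++ List.ofFn R ++ List.ofFn U)
    (B := List.ofFn W ++ List.ofFn S ++ List.ofFn U)
    (by rw [← List.nodup_ofFn]; simp only [List.nodup_append] at hdist; tauto)
    (by rw [← List.nodup_ofFn]; simp only [List.nodup_append] at hdist; tauto)
    (by simp only [List.nodup_append, List.mem_append] at hdist ⊢; grind)
    (by simp only [List.nodup_append, List.mem_append] at hdist ⊢; grind)
    (by simp only [List.mem_append, List.mem_ofFn]; tauto)
    (by simp)
    (List.ofFn W ++ List.ofFn R ++ List.ofFn S ++ List.ofFn U) hdist
    (by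
      have mem_ofFn_iff (n : Nat) (f : Fin n → Nat) (X : Nat) :
          (∃ i, f i = X) ↔ X ∈ List.ofFn f := by simp [List.mem_ofFn]
      have forall_ne_iff (n : Nat) (f : Fin n → Nat) (X : Nat) :
          (∀ i, f i ≠ X) ↔ X ∉ List.ofFn f := by simp [List.mem_ofFn]
      intro X hX
      simp only [List.nodup_append, List.mem_append, OccursTwice, mem_ofFn_iff,
        forall_ne_iff] at hdist hX ⊢
      grind)
  have hne : (List.ofFn W).map gen ++ (List.ofFn R).map gen ++ (List.ofFn U).map gen ≠ [] := by
    simp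
    omega
  rw [monoFormula_congr (τ := gen) (by simp) (by simp)
    (by simp only [List.mem_append]; grind) (by simp only [List.mem_append]; grind)] at key
  rw [conjImp_of_ne_nil hne]
  simpa only [monoFormula, List.map_append, List.ofFn_eq_map] using key
end

section
/- For all n ≥ 2, 1 ≤ i ≤ n, m ≥ 0 and pairwise distinct general atoms R₁,…,R_m, S₁,…,Sₙ, the formula (R₁∧…∧R_m → Sᵢ) → (R₁∧…∧R_m → S₁⊔…⊔Sₙ) is provable in CL2. -/
/-- Formulas built from elementary atoms by ¬, ∧ and ∨. -/
inductive CL2.Elementary : CL2 → Prop where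
  | elem (p : Nat) : Elementary (CL2.elem p)
  | neg {F : CL2} : Elementary F → Elementary (CL2.neg F)
  | land {l : List CL2} : (∀ F ∈ l, Elementary F) → Elementary (CL2.land l)
  | lor {l : List CL2} : (∀ F ∈ l, Elementary F) → Elementary (CL2.lor l)

theorem CL2.Elementary.of_fill {C : SCtx} {G : CL2} (h : Elementary (C.fill G)) :
    Elementary G := by
  induction C with
  | hole => exact h
  | neg C ih => cases h with | neg h => exact ih h
  | land l C r ih => cases h with | land h => exact ih (h _ (by simp))
  | lor l C r ih => cases h with | lor h => exact ih (h _ (by simp))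

theorem CL2.Elementary.imp {F G : CL2} (hF : Elementary F) (hG : Elementary G) :
    Elementary (CL2.imp F G) :=
  .lor (by simpa using ⟨.neg hF, hG⟩)

theorem CL2.Elementary.conjImp {l : List CL2} {t : CL2} (hl : ∀ F ∈ l, Elementary F)
    (ht : Elementary t) : Elementary (conjImp l t) :=
  match l with
  | [] => ht
  | [_] => .imp (hl _ (by simp)) ht
  | _ :: _ :: _ => .imp (.land hl) ht

/-- Rule (a) has no premises when its conclusion is elementary. -/
theorem Provable.of_stable {F : CL2} (hF : F.Elementary) (hs : F.Stable) : Provable F := by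
  refine .ruleA F hs ?_
  rintro H ⟨C, Gs, i, ⟨-, rfl, -⟩ | ⟨-, rfl, -⟩⟩
  · cases hF.of_fill
  · cases hF.of_fill

theorem CL2.elz_eq_self {F : CL2} (hF : F.Elementary) (b : Bool) : elz b F = F := by
  induction hF generalizing b with
  | elem p => simp [elz]
  | neg _ ih => simp [elz, ih]
  | land _ ih =>
    rw [elz, List.attach_map_val (f := elz b), List.map_congr_left fun F hF => ih F hF b,
      List.map_id']
  | lor _ ih =>
    rw [elz, List.attach_map_val (f := elz b), List.map_congr_left fun F hF => ih F hF b,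
      List.map_id']

theorem Provable.imp_self_of_elementary {F : CL2} (hF : F.Elementary) :
    Provable (CL2.imp F F) := by
  refine .of_stable (hF.imp hF) fun v => ?_
  rw [CL2.elz_eq_self (hF.imp hF)]
  simp [CL2.imp, CL2.eval]

/-- Rule (c) applied to the two copies of a general atom in `F → F`. -/
theorem Provable.imp_self_of_elem (C : SCtx) (P p : Nat)
    (hp : CL2.elemOccurs p (C.fill (CL2.gen P)) = false)
    (h : Provable (CL2.imp (C.fill (CL2.elem p)) (C.fill (CL2.elem p)))) :
    Provable (CL2.imp (C.fill (CL2.gen P)) (C.fill (CL2.gen P))) := by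
  refine .ruleC _ _ ⟨.lorS [] (.neg C) [] C [], P, p, rfl, rfl, ?_, ?_⟩ h
  · simp only [DCtx.negCount1, DCtx.negCount2, SCtx.negCount, Nat.even_add_one,
      Nat.odd_add_one, Nat.not_even_iff_odd, Nat.not_odd_iff_even]
    rcases Nat.even_or_odd C.negCount with h | h <;> simp [h]
  · simp [CL2.imp, CL2.elemOccurs, hp]

theorem elemOccurs_conjImp (p : Nat) (l : List CL2) (t : CL2) :
    CL2.elemOccurs p (conjImp l t) = (l.any (CL2.elemOccurs p) || CL2.elemOccurs p t) :=
  match l with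
  | [] => by simp [conjImp]
  | [_] => by simp [conjImp, CL2.imp, CL2.elemOccurs]
  | _ :: _ :: _ => by simp [conjImp, CL2.imp, CL2.elemOccurs, Bool.or_assoc]

theorem exists_sctx_conjImp_antecedent (a b : List CL2) (t : CL2) :
    ∃ C : SCtx, ∀ F, conjImp (a ++ F :: b) t = C.fill F :=
  match a, b with
  | [], [] => ⟨.lor [] (.neg .hole) [t], fun _ => rfl⟩
  | [], c :: b => ⟨.lor [] (.neg (.land [] .hole (c :: b))) [t], fun _ => rfl⟩
  | [c], b => ⟨.lor [] (.neg (.land [c] .hole b)) [t], fun _ => rfl⟩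
  | c :: d :: a, b => ⟨.lor [] (.neg (.land (c :: d :: a) .hole b)) [t], fun _ => rfl⟩

theorem exists_sctx_conjImp_consequent (l : List CL2) :
    ∃ C : SCtx, Even C.negCount ∧ ∀ t, conjImp l t = C.fill t :=
  match l with
  | [] => ⟨.hole, by simp [SCtx.negCount], fun _ => rfl⟩
  | [f] => ⟨.lor [.neg f] .hole [], by simp [SCtx.negCount], fun _ => rfl⟩
  | f :: g :: l =>
    ⟨.lor [.neg (.land (f :: g :: l))] .hole [], by simp [SCtx.negCount], fun _ => rfl⟩

theorem Provable.conjImp_elem_imp_self (r l : List Nat) (q : Nat) :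
    Provable (CL2.imp
      (conjImp (l.map CL2.elem ++ r.map CL2.gen) (CL2.elem q))
      (conjImp (l.map CL2.elem ++ r.map CL2.gen) (CL2.elem q))) := by
  induction r generalizing l with
  | nil =>
    refine .imp_self_of_elementary (.conjImp ?_ (.elem q))
    simpa using fun p _ => CL2.Elementary.elem p
  | cons P r ih =>
    obtain ⟨p, hp⟩ := Infinite.exists_notMem_finset (insert q l.toFinset)
    simp only [Finset.mem_insert, List.mem_toFinset, not_or] at hp
    obtain ⟨C, hC⟩ :=
      exists_sctx_conjImp_antecedent (l.map CL2.elem) (r.map CL2.gen) (CL2.elem q)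
    rw [List.map_cons, hC]
    refine .imp_self_of_elem C P p ?_ ?_
    · rw [← hC, elemOccurs_conjImp]
      simp only [List.any_append, List.any_cons, List.any_map, Bool.or_eq_false_iff,
        List.any_eq_false, CL2.elemOccurs, Function.comp_apply]
      grind
    · rw [← hC]
      simpa using ih (l ++ [p])

theorem Provable.conjImp_gen_imp_self (r : List Nat) (Q : Nat) :
    Provable (CL2.imp
      (conjImp (r.map CL2.gen) (CL2.gen Q)) (conjImp (r.map CL2.gen) (CL2.gen Q))) := by
  obtain ⟨C, -, hC⟩ := exists_sctx_conjImp_consequent (r.map CL2.gen)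
  rw [hC]
  refine .imp_self_of_elem C Q 0 ?_ ?_
  · rw [← hC, elemOccurs_conjImp]
    simp [CL2.elemOccurs]
  · rw [← hC]
    exact .conjImp_elem_imp_self r [] 0

/-- Lemma 8(j): for all n ≥ 2, 1 ≤ i ≤ n, m ≥ 0 and pairwise distinct general atoms
R₁,…,R_m, S₁,…,Sₙ, the formula (R₁∧…∧R_m → Sᵢ) → (R₁∧…∧R_m → S₁⊔…⊔Sₙ)
is provable in CL2. -/
theorem cl2_provable_j (n m : Nat) (hn : 2 ≤ n) (i : Fin n)
    (R : Fin m → Nat) (S : Fin n → Nat)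
    (hdist : (List.ofFn R ++ List.ofFn S).Nodup) :
    Provable (CL2.imp
      (conjImp ((List.ofFn R).map CL2.gen) (CL2.gen (S i)))
      (conjImp ((List.ofFn R).map CL2.gen) (CL2.chor ((List.ofFn S).map CL2.gen)))) := by
  obtain ⟨C, hC, hfill⟩ := exists_sctx_conjImp_consequent ((List.ofFn R).map CL2.gen)
  refine .ruleB _ _ ⟨.lor [.neg (conjImp ((List.ofFn R).map CL2.gen) (CL2.gen (S i)))] C [],
    (List.ofFn S).map CL2.gen, ⟨i, by simp⟩, .inr ⟨hC, ?_, rfl⟩⟩ ?_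
  · rw [hfill (CL2.chor _)]
    rfl
  · have h := Provable.conjImp_gen_imp_self (List.ofFn R) (S i)
    nth_rw 2 [hfill] at h
    simpa [CL2.imp, SCtx.fill] using h
end
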